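/- Let A ∈ ℂ^{m×n} be a nonzero matrix, r_1,…,r_m ∈ ℂ^n the conjugate transposes of the m rows of A, v ∈ ℂ^n a right singular vector corresponding to the largest singular value of A (i.e. v ≠ 0 and ‖Av‖_2 = ‖A‖_{2→2}‖v‖_2), y ∈ ℂ^n a nonzero vector achieving the 1→q norm of A (i.e. ‖Ay‖_q = ‖A‖_{1→q}‖y‖_1), and S = {v, r_1, …, r_m}. Suppose p and q are real numbers with either (1 ≤ p ≤ √2 and 2/(2−p) ≤ q ≤ p/(p−1)) or (√2 ≤ p ≤ 2 and p/(p−1) ≤ q ≤ 2/(2−p)), where p/(p−1) is interpreted as +∞ when p = 1 and 2/(2−p) as +∞ when p = 2, and q < ∞. Then max_{x ∈ S ∪ {y}, x ≠ 0} ‖Ax‖_q/‖x‖_p ≥ [ (2 m^{1/q})^{(q−2)/(q−1)} · n^{(2−p)/p} ]^{−(p−1)/p} · ‖A‖_{p→q}. -/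

import Mathlib

open scoped BigOperators

/-- The `ℓ_p` norm of a vector, for a real exponent `p`. -/
noncomputable def lpnorm {n : ℕ} {𝕜 : Type*} [RCLike 𝕜] (p : ℝ) (x : Fin n → 𝕜) : ℝ :=
  (∑ i, ‖x i‖ ^ p) ^ (1 / p)

/-- The `ℓ_∞` norm of a vector. -/
noncomputable def linorm {n : ℕ} {𝕜 : Type*} [RCLike 𝕜] (x : Fin n → 𝕜) : ℝ :=
  ⨆ i, ‖x i‖

/-- The `p → q` operator norm of a matrix: `max_{x ≠ 0} ‖Ax‖_q / ‖x‖_p`. -/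
noncomputable def opNorm {m n : ℕ} {𝕜 : Type*} [RCLike 𝕜] (p q : ℝ)
    (A : Matrix (Fin m) (Fin n) 𝕜) : ℝ :=
  ⨆ x : {x : Fin n → 𝕜 // x ≠ 0}, lpnorm q (A.mulVec x.1) / lpnorm p x.1

/-- The `p → ∞` operator norm of a matrix: `max_{x ≠ 0} ‖Ax‖_∞ / ‖x‖_p`. -/
noncomputable def opNormInf {m n : ℕ} {𝕜 : Type*} [RCLike 𝕜] (p : ℝ)
    (A : Matrix (Fin m) (Fin n) 𝕜) : ℝ :=
  ⨆ x : {x : Fin n → 𝕜 // x ≠ 0}, linorm (A.mulVec x.1) / lpnorm p x.1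

/-- `row A i` is the conjugate transpose of the `i`-th row of `A`,
so that `(A x) i = ⟨x, row A i⟩` for the standard Hermitian inner product. -/
def row {m n : ℕ} {𝕜 : Type*} [RCLike 𝕜] (A : Matrix (Fin m) (Fin n) 𝕜) (i : Fin m) :
    Fin n → 𝕜 := fun k => star (A i k)

/-- The standard Hermitian inner product `⟨x, y⟩ = ∑ k, x k * conj (y k)`. -/
noncomputable def hinner {n : ℕ} (x y : Fin n → ℂ) : ℂ := ∑ k, x k * star (y k)

section

variable {m n : ℕ} {𝕜 : Type*} [RCLike 𝕜]

lemma sum_norm_rpow_nonneg (p : ℝ) (x : Fin n → 𝕜) : 0 ≤ ∑ i, ‖x i‖ ^ p :=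
  Finset.sum_nonneg fun _ _ => Real.rpow_nonneg (norm_nonneg _) _

lemma lpnorm_nonneg (p : ℝ) (x : Fin n → 𝕜) : 0 ≤ lpnorm p x :=
  Real.rpow_nonneg (sum_norm_rpow_nonneg p x) _

lemma lpnorm_rpow {p : ℝ} (hp : p ≠ 0) (x : Fin n → 𝕜) :
    lpnorm p x ^ p = ∑ i, ‖x i‖ ^ p := by
  rw [lpnorm, ← Real.rpow_mul (sum_norm_rpow_nonneg p x), one_div_mul_cancel hp, Real.rpow_one]

lemma lpnorm_le_iff {p : ℝ} (hp : 0 < p) (x : Fin n → 𝕜) {c : ℝ} (hc : 0 ≤ c) :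
    lpnorm p x ≤ c ↔ ∑ i, ‖x i‖ ^ p ≤ c ^ p := by
  rw [← lpnorm_rpow hp.ne', Real.rpow_le_rpow_iff (lpnorm_nonneg p x) hc hp]

lemma lpnorm_one (x : Fin n → 𝕜) : lpnorm 1 x = ∑ i, ‖x i‖ := by
  simp [lpnorm]

lemma sq_lpnorm_two (x : Fin n → 𝕜) : lpnorm 2 x ^ 2 = ∑ i, ‖x i‖ ^ 2 := by
  have := lpnorm_rpow (two_ne_zero) x
  simpa only [Real.rpow_ofNat] using this

lemma sum_mul_conj (x : Fin n → 𝕜) :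
    ∑ k, x k * (starRingEnd 𝕜) (x k) = ((lpnorm 2 x ^ 2 : ℝ) : 𝕜) := by
  rw [sq_lpnorm_two, RCLike.ofReal_sum]
  simp only [RCLike.mul_conj, RCLike.ofReal_pow]

lemma norm_le_lpnorm {p : ℝ} (hp : 0 < p) (x : Fin n → 𝕜) (i : Fin n) : ‖x i‖ ≤ lpnorm p x := by
  rw [← Real.rpow_le_rpow_iff (norm_nonneg _) (lpnorm_nonneg p x) hp, lpnorm_rpow hp.ne']
  exact Finset.single_le_sum (f := fun i => ‖x i‖ ^ p)
    (fun _ _ => Real.rpow_nonneg (norm_nonneg _) _) (Finset.mem_univ i)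

lemma lpnorm_zero {p : ℝ} (hp : 0 < p) : lpnorm p (0 : Fin n → 𝕜) = 0 := by
  simp [lpnorm, Real.zero_rpow hp.ne', Real.zero_rpow (inv_pos.2 hp).ne']

lemma lpnorm_pos {p : ℝ} (hp : 0 < p) {x : Fin n → 𝕜} (hx : x ≠ 0) : 0 < lpnorm p x := by
  obtain ⟨i, hi⟩ := Function.ne_iff.1 hx
  exact (norm_pos_iff.2 hi).trans_le (norm_le_lpnorm hp x i)

lemma lpnorm_le_lpnorm_one {p : ℝ} (hp : 1 ≤ p) (x : Fin n → 𝕜) : lpnorm p x ≤ lpnorm 1 x := by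
  have h1 : 0 ≤ lpnorm 1 x := lpnorm_nonneg 1 x
  have key (t : ℝ) (ht : 0 ≤ t) : t ^ p = t * t ^ (p - 1) := by
    rw [← Real.rpow_one_add' ht (by linarith)]; congr 1; ring
  rw [lpnorm_le_iff (by linarith) x h1, key _ h1]
  conv_rhs => enter [1]; rw [lpnorm_one]
  rw [Finset.sum_mul]
  refine Finset.sum_le_sum fun i _ => ?_
  rw [key _ (norm_nonneg _)]
  exact mul_le_mul_of_nonneg_left (Real.rpow_le_rpow (norm_nonneg _)
    (norm_le_lpnorm one_pos x i) (by linarith)) (norm_nonneg _)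

lemma lpnorm_le_card_rpow_mul_lpnorm {r s : ℝ} (hr : 0 < r) (hrs : r ≤ s) (x : Fin n → 𝕜) :
    lpnorm r x ≤ (n : ℝ) ^ (1 / r - 1 / s) * lpnorm s x := by
  have hs : 0 < s := hr.trans_le hrs
  have hn : (0 : ℝ) ≤ n := n.cast_nonneg
  rw [← Real.rpow_le_rpow_iff (lpnorm_nonneg r x)
    (mul_nonneg (Real.rpow_nonneg hn _) (lpnorm_nonneg s x)) hs,
    Real.mul_rpow (Real.rpow_nonneg hn _) (lpnorm_nonneg s x), lpnorm_rpow hs.ne',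
    ← Real.rpow_mul hn]
  have h := Real.rpow_sum_le_const_mul_sum_rpow_of_nonneg Finset.univ
    (f := fun i => ‖x i‖ ^ r) (p := s / r) ((one_le_div hr).2 hrs)
    (fun i _ => Real.rpow_nonneg (norm_nonneg _) _)
  rw [← lpnorm_rpow hr.ne', ← Real.rpow_mul (lpnorm_nonneg r x), mul_div_cancel₀ s hr.ne'] at h
  simp only [← Real.rpow_mul (norm_nonneg _), mul_div_cancel₀ s hr.ne', Finset.card_univ,
    Fintype.card_fin] at h
  convert h using 3
  field_simp

lemma norm_sum_mul_le_lpnorm_mul_lpnorm {p q : ℝ} (hpq : p.HolderConjugate q)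
    (x y : Fin n → 𝕜) : ‖∑ i, x i * y i‖ ≤ lpnorm p x * lpnorm q y := by
  refine (norm_sum_le _ _).trans ?_
  simp only [norm_mul]
  exact Real.inner_le_Lp_mul_Lq_of_nonneg _ hpq (fun _ _ => norm_nonneg _)
    (fun _ _ => norm_nonneg _)

/-- Log-convexity of the `ℓ_p` norms, between the exponents `2` and `2 * q`. -/
lemma lpnorm_le_lpnorm_two_rpow_mul {q : ℝ} (hq : 2 ≤ q) (x : Fin n → 𝕜) :
    lpnorm q x ≤ lpnorm 2 x ^ (1 / (q - 1)) * lpnorm (2 * q) x ^ ((q - 2) / (q - 1)) := by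
  rcases hq.eq_or_lt with rfl | hq2
  · norm_num
  have h1 : 0 < q - 1 := by linarith
  have h2 : 0 < q - 2 := by linarith
  have hq0 : 0 < q := by linarith
  have hu := lpnorm_nonneg 2 x
  have hw := lpnorm_nonneg (2 * q) x
  have hc : (2 * (q - 1) / q).HolderConjugate (2 * (q - 1) / (q - 2)) := by
    rw [Real.holderConjugate_iff]
    constructor
    · rw [lt_div_iff₀ hq0]; linarith
    · field_simp; ring
  have h := Real.inner_le_Lp_mul_Lq_of_nonneg Finset.univ hc
    (f := fun i => ‖x i‖ ^ (q / (q - 1))) (g := fun i => ‖x i‖ ^ (q * (q - 2) / (q - 1)))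
    (fun _ _ => Real.rpow_nonneg (norm_nonneg _) _) (fun _ _ => Real.rpow_nonneg (norm_nonneg _) _)
  have e1 : q / (q - 1) * (2 * (q - 1) / q) = 2 := by field_simp
  have e2 : q * (q - 2) / (q - 1) * (2 * (q - 1) / (q - 2)) = 2 * q := by field_simp
  have e3 : q / (q - 1) + q * (q - 2) / (q - 1) = q := by field_simp; ring
  have e4 : 2 * (1 / (2 * (q - 1) / q)) = 1 / (q - 1) * q := by field_simp
  have e5 : 2 * q * (1 / (2 * (q - 1) / (q - 2))) = (q - 2) / (q - 1) * q := by field_simp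
  simp only [← Real.rpow_mul (norm_nonneg _)] at h
  rw [e1, e2, ← lpnorm_rpow two_ne_zero, ← lpnorm_rpow (by positivity), ← Real.rpow_mul hu,
    ← Real.rpow_mul hw, e4, e5, Real.rpow_mul hu, Real.rpow_mul hw,
    ← Real.mul_rpow (by positivity) (by positivity)] at h
  rw [lpnorm_le_iff hq0 x (by positivity)]
  refine le_trans (le_of_eq (Finset.sum_congr rfl fun i _ => ?_)) h
  rw [← Real.rpow_add_of_nonneg (norm_nonneg _) (by positivity) (by positivity), e3]

/-- The vector `φ` with `φ i * x i = ‖x i‖ ^ s`, dual to `x` in the `ℓ_s` norm. -/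
noncomputable def dualVec (s : ℝ) (x : Fin n → 𝕜) : Fin n → 𝕜 :=
  fun i => (starRingEnd 𝕜) (x i) * ((‖x i‖ ^ (s - 2) : ℝ) : 𝕜)

lemma norm_dualVec {s : ℝ} (hs : 1 < s) (x : Fin n → 𝕜) (i : Fin n) :
    ‖dualVec s x i‖ = ‖x i‖ ^ (s - 1) := by
  rw [dualVec, norm_mul, RCLike.norm_conj, RCLike.norm_ofReal,
    abs_of_nonneg (Real.rpow_nonneg (norm_nonneg _) _),
    ← Real.rpow_one_add' (norm_nonneg _) (by linarith)]
  congr 1; ring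

lemma dualVec_mul {s : ℝ} (hs : 0 < s) (x : Fin n → 𝕜) (i : Fin n) :
    dualVec s x i * x i = ((‖x i‖ ^ s : ℝ) : 𝕜) := by
  rw [dualVec, mul_right_comm, RCLike.conj_mul, ← RCLike.ofReal_pow, ← RCLike.ofReal_mul,
    ← Real.rpow_ofNat, ← Real.rpow_add' (norm_nonneg _) (by simpa using hs.ne')]
  congr 2; ring

lemma sum_dualVec_mul {s : ℝ} (hs : 0 < s) (x : Fin n → 𝕜) :
    ∑ i, dualVec s x i * x i = ((lpnorm s x ^ s : ℝ) : 𝕜) := by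
  rw [lpnorm_rpow hs.ne', RCLike.ofReal_sum]
  exact Finset.sum_congr rfl fun i _ => dualVec_mul hs x i

lemma lpnorm_dualVec {q q' : ℝ} (hqq : q.HolderConjugate q') (x : Fin n → 𝕜) :
    lpnorm q' (dualVec q x) = lpnorm q x ^ (q - 1) := by
  have hq := hqq.lt
  have e : (q - 1) * q' = q := hqq.sub_one_mul_conj
  have h0 : q' ≠ 0 := hqq.symm.ne_zero
  rw [lpnorm]
  simp only [norm_dualVec hq, ← Real.rpow_mul (norm_nonneg _)]
  rw [e, ← lpnorm_rpow hqq.ne_zero, ← Real.rpow_mul (lpnorm_nonneg q x)]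
  congr 1
  rw [mul_one_div, div_eq_iff h0, e]

/-- Hölder interpolation on the domain side between `1 → q` and `2 → q` bounds. -/
lemma lpnorm_mulVec_le_of_one_of_two {p q C₁ C₂ : ℝ} (hp1 : 1 < p) (hp2 : p ≤ 2) (hq : 1 < q)
    (hC₁ : 0 ≤ C₁) (hC₂ : 0 ≤ C₂) (A : Matrix (Fin m) (Fin n) 𝕜)
    (h1 : ∀ k, lpnorm q (fun i => A i k) ≤ C₁)
    (h2 : ∀ x, lpnorm q (A.mulVec x) ≤ C₂ * lpnorm 2 x) (x : Fin n → 𝕜) :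
    lpnorm q (A.mulVec x) ≤ C₁ ^ ((2 - p) / p) * C₂ ^ (2 * (p - 1) / p) * lpnorm p x := by
  have hq' := Real.HolderConjugate.conjExponent hq
  have hp' := Real.HolderConjugate.conjExponent hp1
  set q' := q.conjExponent
  set p' := p.conjExponent with hp'd
  set a := A.mulVec x with ha
  set g := dualVec q a with hg
  set h : Fin n → 𝕜 := Matrix.vecMul g A with hh
  set G := lpnorm q a ^ (q - 1) with hG
  have hG0 : 0 ≤ G := Real.rpow_nonneg (lpnorm_nonneg _ _) _
  have hgG : lpnorm q' g = G := lpnorm_dualVec hq' a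
  have hdual (z : Fin n → 𝕜) : ∑ k, h k * z k = ∑ i, g i * A.mulVec z i :=
    (Matrix.dotProduct_mulVec g A z).symm
  have hsup (k : Fin n) : ‖h k‖ ≤ G * C₁ := by
    refine (norm_sum_mul_le_lpnorm_mul_lpnorm hq'.symm g (fun i => A i k)).trans ?_
    rw [hgG]
    exact mul_le_mul_of_nonneg_left (h1 k) hG0
  have htwo : lpnorm 2 h ≤ G * C₂ := by
    have e : lpnorm 2 h ^ 2 ≤ G * C₂ * lpnorm 2 h := by
      have e2 : lpnorm 2 h ^ 2 = ‖∑ i, g i * A.mulVec (fun k => (starRingEnd 𝕜) (h k)) i‖ := by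
        rw [← hdual (fun k => (starRingEnd 𝕜) (h k)), sum_mul_conj, RCLike.norm_ofReal,
          abs_of_nonneg (by positivity)]
      have e3 : lpnorm 2 (fun k => (starRingEnd 𝕜) (h k)) = lpnorm 2 h := by
        simp [lpnorm]
      rw [e2]
      refine (norm_sum_mul_le_lpnorm_mul_lpnorm hq'.symm _ _).trans ?_
      rw [hgG, mul_assoc]
      refine mul_le_mul_of_nonneg_left ((h2 _).trans ?_) hG0
      rw [e3]
    rcases (lpnorm_nonneg 2 h).eq_or_lt with h0 | h0
    · rw [← h0]; positivity
    · rw [sq] at e; exact le_of_mul_le_mul_right e h0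
  have hp0 : 0 < p := by linarith
  have hp10 : 0 < p - 1 := by linarith
  have hp'e : p' = p / (p - 1) := rfl
  have hp'0 : 0 < p' := hp'.symm.pos
  have hp'2 : 0 ≤ p' - 2 := by
    rw [hp'e, sub_nonneg, le_div_iff₀ hp10]; linarith
  have hlp : lpnorm p' h ≤ G * (C₁ ^ ((2 - p) / p) * C₂ ^ (2 * (p - 1) / p)) := by
    have e1 : (2 - p) / p * p' = p' - 2 := by rw [hp'e]; field_simp; ring
    have e2 : 2 * (p - 1) / p * p' = 2 := by rw [hp'e]; field_simp
    rw [lpnorm_le_iff hp'0 h (by positivity), Real.mul_rpow hG0 (by positivity),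
      Real.mul_rpow (by positivity) (by positivity), ← Real.rpow_mul hC₁, ← Real.rpow_mul hC₂,
      e1, e2]
    calc ∑ i, ‖h i‖ ^ p' ≤ ∑ i, (G * C₁) ^ (p' - 2) * ‖h i‖ ^ 2 := by
          refine Finset.sum_le_sum fun i _ => ?_
          have : ‖h i‖ ^ p' = ‖h i‖ ^ (p' - 2) * ‖h i‖ ^ 2 := by
            rw [← Real.rpow_ofNat, ← Real.rpow_add' (norm_nonneg _) (by simpa using hp'0.ne')]
            congr 1; ring
          rw [this]
          exact mul_le_mul_of_nonneg_right
            (Real.rpow_le_rpow (norm_nonneg _) (hsup i) hp'2) (by positivity)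
      _ = (G * C₁) ^ (p' - 2) * lpnorm 2 h ^ 2 := by rw [← Finset.mul_sum, sq_lpnorm_two]
      _ ≤ (G * C₁) ^ (p' - 2) * (G * C₂) ^ 2 := by
          have := lpnorm_nonneg 2 h
          gcongr
      _ = G ^ p' * (C₁ ^ (p' - 2) * C₂ ^ (2 : ℝ)) := by
          have : G ^ p' = G ^ (p' - 2) * G ^ 2 := by
            rw [← Real.rpow_ofNat, ← Real.rpow_add' hG0 (by simpa using hp'0.ne')]
            congr 1; ring
          rw [this, Real.mul_rpow hG0 hC₁, Real.rpow_ofNat]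
          ring
  have hmain : G * lpnorm q a ≤
      G * (C₁ ^ ((2 - p) / p) * C₂ ^ (2 * (p - 1) / p) * lpnorm p x) := by
    have e1 : G * lpnorm q a = ‖∑ k, h k * x k‖ := by
      rw [hdual x, ← ha, sum_dualVec_mul (by linarith), RCLike.norm_ofReal,
        abs_of_nonneg (Real.rpow_nonneg (lpnorm_nonneg _ _) _), hG,
        ← Real.rpow_add_one' (lpnorm_nonneg _ _) (by linarith), sub_add_cancel]
    rw [e1, ← mul_assoc]
    exact (norm_sum_mul_le_lpnorm_mul_lpnorm hp'.symm h x).trans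
      (mul_le_mul_of_nonneg_right hlp (lpnorm_nonneg p x))
  rcases (lpnorm_nonneg q a).eq_or_lt with h0 | h0
  · rw [← h0]
    have := lpnorm_nonneg p x
    positivity
  · exact le_of_mul_le_mul_left hmain (Real.rpow_pos_of_pos h0 _)

lemma lpnorm_single {p : ℝ} (hp : 0 < p) (k : Fin n) :
    lpnorm p (Pi.single k 1 : Fin n → 𝕜) = 1 := by
  rw [lpnorm, Finset.sum_eq_single k]
  · simp
  · intro j _ hj
    simp [Pi.single_eq_of_ne hj, Real.zero_rpow hp.ne']
  · simp

lemma mulVec_row_apply_comm (A : Matrix (Fin m) (Fin n) 𝕜) (i j : Fin m) :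
    ‖A.mulVec (row A i) j‖ = ‖A.mulVec (row A j) i‖ := by
  rw [← norm_star (A.mulVec (row A i) j)]
  simp [Matrix.mulVec, dotProduct, row, mul_comm]

lemma mulVec_row_apply_self (A : Matrix (Fin m) (Fin n) 𝕜) (i : Fin m) :
    A.mulVec (row A i) i = ((lpnorm 2 (row A i) ^ 2 : ℝ) : 𝕜) := by
  rw [sq_lpnorm_two, RCLike.ofReal_sum]
  simp [Matrix.mulVec, dotProduct, row, RCLike.mul_conj]

/-- A bound on the `ℓ_q` norm of `A` on its own rows yields a `2 → 2 * q` bound. -/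
lemma lpnorm_two_mul_mulVec_le {q B : ℝ} (hq : 1 < q) (hB : 0 ≤ B)
    (A : Matrix (Fin m) (Fin n) 𝕜)
    (hrow : ∀ i, lpnorm q (A.mulVec (row A i)) ≤ B * lpnorm 2 (row A i)) (x : Fin n → 𝕜) :
    lpnorm (2 * q) (A.mulVec x) ≤ B * lpnorm 2 x := by
  have hrow' (i : Fin m) : lpnorm q (A.mulVec (row A i)) ≤ B ^ 2 := by
    have h0 := lpnorm_nonneg 2 (row A i)
    have h1 : lpnorm 2 (row A i) ≤ B := by
      have h2 := (norm_le_lpnorm (by linarith) _ i).trans (hrow i)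
      rw [mulVec_row_apply_self, RCLike.norm_ofReal, abs_of_nonneg (by positivity)] at h2
      rcases h0.eq_or_lt with h | h
      · rwa [← h]
      · rw [sq] at h2; exact le_of_mul_le_mul_right h2 h
    calc _ ≤ B * lpnorm 2 (row A i) := hrow i
      _ ≤ B ^ 2 := by rw [sq]; gcongr
  have hq' := Real.HolderConjugate.conjExponent hq
  set q' := q.conjExponent
  set a := A.mulVec x with ha
  set g := dualVec (2 * q) a with hg
  set h : Fin n → 𝕜 := Matrix.vecMul g A with hh
  set L := lpnorm (2 * q) a with hL
  have hL0 : 0 ≤ L := lpnorm_nonneg _ _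
  have hdual (z : Fin n → 𝕜) : ∑ k, h k * z k = ∑ i, g i * A.mulVec z i :=
    (Matrix.dotProduct_mulVec g A z).symm
  have hdom : L ^ (2 * q) ≤ lpnorm 2 h * lpnorm 2 x := by
    have : L ^ (2 * q) = ‖∑ k, h k * x k‖ := by
      rw [hdual x, ← ha, sum_dualVec_mul (by linarith), RCLike.norm_ofReal,
        abs_of_nonneg (Real.rpow_nonneg (lpnorm_nonneg _ _) _)]
    rw [this]
    exact norm_sum_mul_le_lpnorm_mul_lpnorm Real.HolderConjugate.two_two h x
  have hnorm (i : Fin m) : ‖g i‖ = ‖a i‖ * ‖a i‖ ^ (2 * q - 2) := by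
    rw [hg, norm_dualVec (by linarith), ← Real.rpow_one_add' (norm_nonneg _) (by linarith)]
    congr 1; ring
  have hexp : (2 * q - 2) * q' = 2 * q := by
    linear_combination 2 * hq'.sub_one_mul_conj
  have hh2 : lpnorm 2 h ^ 2 ≤ L ^ (2 * q) * (L ^ (2 * q - 2) * B ^ 2) := by
    set β : Fin m → ℝ := fun i => ‖a i‖ ^ (2 * q - 2) with hβ
    set H : Fin m → Fin m → ℝ := fun i j => ‖A.mulVec (row A i) j‖ with hH
    have hβ0 (i : Fin m) : 0 ≤ β i := Real.rpow_nonneg (norm_nonneg _) _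
    have hHsymm (i j : Fin m) : H i j = H j i := mulVec_row_apply_comm A i j
    have hexpand (i : Fin m) : A.mulVec (fun k => (starRingEnd 𝕜) (h k)) i =
        ∑ j, (starRingEnd 𝕜) (g j) * A.mulVec (row A j) i := by
      simp only [hh, Matrix.mulVec, Matrix.vecMul, dotProduct, row, map_sum, map_mul,
        Finset.mul_sum]
      rw [Finset.sum_comm]
      refine Finset.sum_congr rfl fun j _ => Finset.sum_congr rfl fun k _ => ?_
      rw [starRingEnd_apply, starRingEnd_apply]
      ring
    have hsq : lpnorm 2 h ^ 2 ≤ ∑ i, ∑ j, (‖a i‖ * β i) * (‖a j‖ * β j) * H i j := by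
      have e2 : lpnorm 2 h ^ 2 = ‖∑ i, g i * A.mulVec (fun k => (starRingEnd 𝕜) (h k)) i‖ := by
        rw [← hdual (fun k => (starRingEnd 𝕜) (h k)), sum_mul_conj, RCLike.norm_ofReal,
          abs_of_nonneg (by positivity)]
      rw [e2]
      refine (norm_sum_le _ _).trans (Finset.sum_le_sum fun i _ => ?_)
      rw [hexpand, Finset.mul_sum]
      refine (norm_sum_le _ _).trans (Finset.sum_le_sum fun j _ => le_of_eq ?_)
      rw [norm_mul, norm_mul, RCLike.norm_conj, hnorm, hnorm, mulVec_row_apply_comm, ← mul_assoc]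
    have hamgm : ∑ i, ∑ j, (‖a i‖ * β i) * (‖a j‖ * β j) * H i j ≤
        ∑ i, ∑ j, ‖a i‖ ^ 2 * β i * (β j * H i j) := by
      have hswap : ∑ i, ∑ j, ‖a j‖ ^ 2 * β j * (β i * H i j) =
          ∑ i, ∑ j, ‖a i‖ ^ 2 * β i * (β j * H i j) := by
        rw [Finset.sum_comm]
        exact Finset.sum_congr rfl fun i _ => Finset.sum_congr rfl fun j _ => by rw [hHsymm j i]
      have hle : 2 * ∑ i, ∑ j, (‖a i‖ * β i) * (‖a j‖ * β j) * H i j ≤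
          ∑ i, ∑ j, ‖a i‖ ^ 2 * β i * (β j * H i j) +
          ∑ i, ∑ j, ‖a j‖ ^ 2 * β j * (β i * H i j) := by
        simp only [Finset.mul_sum, ← Finset.sum_add_distrib]
        refine Finset.sum_le_sum fun i _ => Finset.sum_le_sum fun j _ => ?_
        have hw : 0 ≤ β i * β j * H i j :=
          mul_nonneg (mul_nonneg (hβ0 i) (hβ0 j)) (norm_nonneg _)
        linarith [mul_nonneg hw (sq_nonneg (‖a i‖ - ‖a j‖))]
      linarith
    have hinner (i : Fin m) : ∑ j, β j * H i j ≤ L ^ (2 * q - 2) * B ^ 2 := by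
      refine (Real.inner_le_Lp_mul_Lq_of_nonneg Finset.univ hq'.symm (fun j _ => hβ0 j)
        (fun j _ => norm_nonneg _)).trans (mul_le_mul (le_of_eq ?_) (hrow' i)
        (lpnorm_nonneg q (A.mulVec (row A i))) (by positivity))
      simp only [hβ, ← Real.rpow_mul (norm_nonneg _)]
      rw [hexp, ← lpnorm_rpow (by linarith), ← Real.rpow_mul hL0, mul_one_div,
        (div_eq_iff hq'.symm.ne_zero).2 hexp.symm]
    calc lpnorm 2 h ^ 2 ≤ ∑ i, ∑ j, ‖a i‖ ^ 2 * β i * (β j * H i j) := hsq.trans hamgm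
      _ ≤ ∑ i, ‖a i‖ ^ (2 * q) * (L ^ (2 * q - 2) * B ^ 2) := by
        refine Finset.sum_le_sum fun i _ => ?_
        have e : ‖a i‖ ^ (2 * q) = ‖a i‖ ^ 2 * β i := by
          rw [hβ, ← Real.rpow_ofNat, ← Real.rpow_add' (norm_nonneg _) (by linarith)]
          congr 1; ring
        rw [e, ← Finset.mul_sum]
        exact mul_le_mul_of_nonneg_left (hinner i) (mul_nonneg (sq_nonneg _) (hβ0 i))
      _ = L ^ (2 * q) * (L ^ (2 * q - 2) * B ^ 2) := by
        rw [← Finset.sum_mul, lpnorm_rpow (by linarith)]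
  have hh2' : lpnorm 2 h ≤ L ^ (2 * q - 1) * B := by
    refine (sq_le_sq₀ (lpnorm_nonneg 2 h) (by positivity)).1 (hh2.trans (le_of_eq ?_))
    rw [← mul_assoc, ← Real.rpow_add' hL0 (by linarith), mul_pow, ← Real.rpow_mul_natCast hL0]
    congr 2; push_cast; ring
  have hfin : L ^ (2 * q - 1) * L ≤ L ^ (2 * q - 1) * (B * lpnorm 2 x) := by
    rw [← Real.rpow_add_one' hL0 (by linarith), sub_add_cancel, ← mul_assoc]
    exact hdom.trans (mul_le_mul_of_nonneg_right hh2' (lpnorm_nonneg 2 x))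
  rcases hL0.eq_or_lt with h0 | h0
  · rw [← h0]
    exact mul_nonneg hB (lpnorm_nonneg 2 x)
  · exact le_of_mul_le_mul_left hfin (Real.rpow_pos_of_pos h0 _)

/-- Bounds on the rows and on the `2 → 2` norm of `A` yield a `2 → q` bound. -/
lemma lpnorm_mulVec_le_of_row {q B : ℝ} (hq : 2 ≤ q) (hB : 0 ≤ B)
    (A : Matrix (Fin m) (Fin n) 𝕜)
    (hrow : ∀ i, lpnorm q (A.mulVec (row A i)) ≤ B * lpnorm 2 (row A i))
    (htwo : ∀ x, lpnorm 2 (A.mulVec x) ≤ (m : ℝ) ^ (1 / 2 - 1 / q) * B * lpnorm 2 x)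
    (x : Fin n → 𝕜) :
    lpnorm q (A.mulVec x) ≤
      ((m : ℝ) ^ (1 / q)) ^ ((q - 2) / (2 * (q - 1))) * B * lpnorm 2 x := by
  have h1 : 0 < q - 1 := by linarith
  have h2 : 0 ≤ q - 2 := by linarith
  have hm : (0 : ℝ) ≤ m := m.cast_nonneg
  have hX : 0 ≤ B * lpnorm 2 x := mul_nonneg hB (lpnorm_nonneg _ _)
  have ha := lpnorm_nonneg 2 (A.mulVec x)
  have hb := lpnorm_nonneg (2 * q) (A.mulVec x)
  calc lpnorm q (A.mulVec x)
      ≤ lpnorm 2 (A.mulVec x) ^ (1 / (q - 1)) *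
        lpnorm (2 * q) (A.mulVec x) ^ ((q - 2) / (q - 1)) := lpnorm_le_lpnorm_two_rpow_mul hq _
    _ ≤ ((m : ℝ) ^ (1 / 2 - 1 / q) * (B * lpnorm 2 x)) ^ (1 / (q - 1)) *
        (B * lpnorm 2 x) ^ ((q - 2) / (q - 1)) := by
        have := htwo x
        rw [mul_assoc] at this
        gcongr
        exact lpnorm_two_mul_mulVec_le (by linarith) hB A hrow x
    _ = ((m : ℝ) ^ (1 / q)) ^ ((q - 2) / (2 * (q - 1))) * B * lpnorm 2 x := by
        rw [Real.mul_rpow (by positivity) hX, mul_assoc, ← Real.rpow_add_of_nonneg hX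
          (by positivity) (by positivity), ← Real.rpow_mul hm, ← Real.rpow_mul hm, mul_assoc]
        have e1 : 1 / (q - 1) + (q - 2) / (q - 1) = 1 := by field_simp; ring
        have e2 : (1 / 2 - 1 / q) * (1 / (q - 1)) = 1 / q * ((q - 2) / (2 * (q - 1))) := by
          have : q ≠ 0 := by linarith
          field_simp
        rw [e1, e2, Real.rpow_one]

lemma bddAbove_range_lpnorm_div {p q : ℝ} (hp : 0 < p) (hq : 0 < q)
    (A : Matrix (Fin m) (Fin n) 𝕜) :
    BddAbove (Set.range fun x : {x : Fin n → 𝕜 // x ≠ 0} =>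
      lpnorm q (A.mulVec x.1) / lpnorm p x.1) := by
  refine ⟨(∑ i, (∑ k, ‖A i k‖) ^ q) ^ (1 / q), ?_⟩
  rintro _ ⟨⟨x, hx⟩, rfl⟩
  have hpos := lpnorm_pos hp hx
  have hc (i : Fin m) : 0 ≤ ∑ k, ‖A i k‖ := Finset.sum_nonneg fun _ _ => norm_nonneg _
  have hS : 0 ≤ ∑ i, (∑ k, ‖A i k‖) ^ q :=
    Finset.sum_nonneg fun i _ => Real.rpow_nonneg (hc i) _
  rw [div_le_iff₀ hpos, lpnorm_le_iff hq _ (by positivity), Real.mul_rpow (by positivity) hpos.le,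
    ← Real.rpow_mul hS, one_div_mul_cancel hq.ne', Real.rpow_one, Finset.sum_mul]
  refine Finset.sum_le_sum fun i _ => ?_
  rw [← Real.mul_rpow (hc i) hpos.le, Finset.sum_mul]
  refine Real.rpow_le_rpow (norm_nonneg _) ?_ hq.le
  refine (norm_sum_le Finset.univ fun k => A i k * x k).trans ?_
  refine Finset.sum_le_sum fun k _ => ?_
  rw [norm_mul]
  exact mul_le_mul_of_nonneg_left (norm_le_lpnorm hp x k) (norm_nonneg _)

lemma lpnorm_mulVec_le_opNorm {p q : ℝ} (hp : 0 < p) (hq : 0 < q)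
    (A : Matrix (Fin m) (Fin n) 𝕜) (x : Fin n → 𝕜) :
    lpnorm q (A.mulVec x) ≤ opNorm p q A * lpnorm p x := by
  rcases eq_or_ne x 0 with rfl | hx
  · simp [lpnorm_zero hp, lpnorm_zero hq]
  · rw [← div_le_iff₀ (lpnorm_pos hp hx)]
    exact le_ciSup (bddAbove_range_lpnorm_div hp hq A) ⟨x, hx⟩

lemma opNorm_le_of_forall {p q C : ℝ} (hp : 0 < p) (A : Matrix (Fin m) (Fin n) 𝕜)
    {x₀ : Fin n → 𝕜} (hx₀ : x₀ ≠ 0) (h : ∀ x, lpnorm q (A.mulVec x) ≤ C * lpnorm p x) :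
    opNorm p q A ≤ C := by
  have : Nonempty {x : Fin n → 𝕜 // x ≠ 0} := ⟨⟨x₀, hx₀⟩⟩
  exact ciSup_le fun x => (div_le_iff₀ (lpnorm_pos hp x.2)).2 (h x)

end

theorem stmt2 {m n : ℕ} (p q : ℝ)
    (hpq : (1 ≤ p ∧ p ≤ Real.sqrt 2 ∧ 2 / (2 - p) ≤ q ∧ (p = 1 ∨ q ≤ p / (p - 1))) ∨
           (Real.sqrt 2 ≤ p ∧ p ≤ 2 ∧ p / (p - 1) ≤ q ∧ (p = 2 ∨ q ≤ 2 / (2 - p))))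
    (A : Matrix (Fin m) (Fin n) ℂ) (hA : A ≠ 0)
    (v : Fin n → ℂ) (hv : v ≠ 0)
    (hsv : lpnorm 2 (A.mulVec v) = opNorm 2 2 A * lpnorm 2 v)
    (y : Fin n → ℂ) (hy0 : y ≠ 0)
    (hy : lpnorm q (A.mulVec y) = opNorm 1 q A * lpnorm 1 y)
    (M : ℝ)
    (hM : M = sSup {t : ℝ | ∃ x ∈ insert y (insert v (Set.range (row A))), x ≠ 0 ∧
      t = lpnorm q (A.mulVec x) / lpnorm p x}) :
    M ≥ ((2 * (m : ℝ) ^ (1 / q)) ^ ((q - 2) / (q - 1)) * (n : ℝ) ^ ((2 - p) / p)) ^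
        (-((p - 1) / p)) * opNorm p q A := by
  
  have hp1 : 1 ≤ p := by
    rcases hpq with h | h
    · exact h.1
    · exact Real.one_lt_sqrt_two.le.trans h.1
  have hsqrt : Real.sqrt 2 < 2 := Real.sqrt_two_lt_three_halves.trans (by norm_num)
  have hp2 : p ≤ 2 := by
    rcases hpq with h | h
    · exact h.2.1.trans hsqrt.le
    · exact h.2.1
  have hq : 2 ≤ q := by
    rcases hpq with h | h
    · refine le_trans ?_ h.2.2.1
      rw [le_div_iff₀ (by linarith [h.2.1])]
      linarith
    · refine le_trans ?_ h.2.2.1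
      rw [le_div_iff₀ (by linarith [Real.one_lt_sqrt_two, h.1])]
      linarith
  have hp0 : 0 < p := by linarith
  have hq0 : 0 < q := by linarith
  have hn : 0 < n := by
    obtain ⟨k, -⟩ := Function.ne_iff.1 hy0
    exact k.pos
  have hm : 0 < m := by
    by_contra! h
    obtain rfl : m = 0 := by omega
    exact hA (Subsingleton.elim _ _)
  have hn' : (0 : ℝ) < n := Nat.cast_pos.2 hn
  have hm' : (0 : ℝ) < m := Nat.cast_pos.2 hm
  set S := insert y (insert v (Set.range (row A))) with hS
  have hle (x : Fin n → ℂ) (hx : x ∈ S) : lpnorm q (A.mulVec x) ≤ M * lpnorm p x := by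
    rcases eq_or_ne x 0 with rfl | hx0
    · simp [lpnorm_zero hp0, lpnorm_zero hq0]
    rw [← div_le_iff₀ (lpnorm_pos hp0 hx0), hM]
    refine le_csSup (Set.Finite.bddAbove ?_) ⟨x, hx, hx0, rfl⟩
    refine (((Set.finite_range (row A)).insert v |>.insert y).image
      fun x => lpnorm q (A.mulVec x) / lpnorm p x).subset ?_
    rintro _ ⟨z, hz, -, rfl⟩
    exact ⟨z, hz, rfl⟩
  have hyS : y ∈ S := Set.mem_insert _ _
  have hvS : v ∈ S := Set.mem_insert_of_mem _ (Set.mem_insert _ _)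
  have hrS (i : Fin m) : row A i ∈ S :=
    Set.mem_insert_of_mem _ (Set.mem_insert_of_mem _ ⟨i, rfl⟩)
  have hM0 : 0 ≤ M :=
    nonneg_of_mul_nonneg_left ((lpnorm_nonneg _ _).trans (hle y hyS)) (lpnorm_pos hp0 hy0)
  have hone : opNorm 1 q A ≤ M := by
    refine le_of_mul_le_mul_right ?_ (lpnorm_pos one_pos hy0)
    rw [← hy]
    exact (hle y hyS).trans (mul_le_mul_of_nonneg_left (lpnorm_le_lpnorm_one hp1 y) hM0)
  rcases hp1.eq_or_lt with rfl | hp1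
  · simpa using hone
  have hcol (k : Fin n) : lpnorm q (fun i => A i k) ≤ M := by
    have h := lpnorm_mulVec_le_opNorm one_pos hq0 A (Pi.single k 1)
    rw [lpnorm_single one_pos, mul_one, Matrix.mulVec_single_one] at h
    exact h.trans hone
  set B := (n : ℝ) ^ (1 / p - 1 / 2) * M with hB
  have hB0 : 0 ≤ B := by positivity
  have hle2 (x : Fin n → ℂ) (hx : x ∈ S) : lpnorm q (A.mulVec x) ≤ B * lpnorm 2 x := by
    rw [hB, mul_right_comm, mul_comm]
    exact (hle x hx).trans
      (mul_le_mul_of_nonneg_left (lpnorm_le_card_rpow_mul_lpnorm hp0 hp2 x) hM0)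
  have htwo (x : Fin n → ℂ) :
      lpnorm 2 (A.mulVec x) ≤ (m : ℝ) ^ (1 / 2 - 1 / q) * B * lpnorm 2 x := by
    refine (lpnorm_mulVec_le_opNorm two_pos two_pos A x).trans
      (mul_le_mul_of_nonneg_right ?_ (lpnorm_nonneg 2 x))
    refine le_of_mul_le_mul_right ?_ (lpnorm_pos two_pos hv)
    rw [← hsv, mul_assoc]
    exact (lpnorm_le_card_rpow_mul_lpnorm two_pos hq _).trans
      (mul_le_mul_of_nonneg_left (hle2 v hvS) (by positivity))
  have h2q := lpnorm_mulVec_le_of_row hq hB0 A (fun i => hle2 _ (hrS i)) htwo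
  have hop := opNorm_le_of_forall hp0 A hy0
    (lpnorm_mulVec_le_of_one_of_two hp1 hp2 (by linarith) hM0 (by positivity) A hcol h2q)
  have hq1 : 0 < q - 1 := by linarith
  have hq2 : 0 ≤ q - 2 := by linarith
  have hp10 : 0 < p - 1 := by linarith
  rw [ge_iff_le, Real.rpow_neg (by positivity), inv_mul_le_iff₀ (by positivity)]
  refine hop.trans ?_
  set c := (m : ℝ) ^ (1 / q) with hc
  have hc0 : 0 < c := by positivity
  have hMexp : M ^ ((2 - p) / p) * M ^ (2 * (p - 1) / p) = M := by
    have e : (2 - p) / p + 2 * (p - 1) / p = 1 := by field_simp; ring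
    rw [← Real.rpow_add' hM0 (by rw [e]; exact one_ne_zero), e, Real.rpow_one]
  calc M ^ ((2 - p) / p) * (c ^ ((q - 2) / (2 * (q - 1))) * B) ^ (2 * (p - 1) / p)
      = (c ^ ((q - 2) / (q - 1)) * (n : ℝ) ^ ((2 - p) / p)) ^ ((p - 1) / p) *
          (M ^ ((2 - p) / p) * M ^ (2 * (p - 1) / p)) := by
        have e1 : (q - 2) / (2 * (q - 1)) * (2 * (p - 1) / p) =
            (q - 2) / (q - 1) * ((p - 1) / p) := by field_simp
        have e2 : (1 / p - 1 / 2) * (2 * (p - 1) / p) = (2 - p) / p * ((p - 1) / p) := by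
          field_simp
        rw [hB, Real.mul_rpow (by positivity) (by positivity),
          Real.mul_rpow (by positivity) hM0, Real.mul_rpow (by positivity) (by positivity),
          ← Real.rpow_mul hc0.le, ← Real.rpow_mul hc0.le, ← Real.rpow_mul hn'.le,
          ← Real.rpow_mul hn'.le, e1, e2]
        ring
    _ ≤ ((2 * c) ^ ((q - 2) / (q - 1)) * (n : ℝ) ^ ((2 - p) / p)) ^ ((p - 1) / p) * M := by
        rw [hMexp]
        gcongr
        linarith
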